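/- Let φ be a 3-SAT formula with clauses C_1, ..., C_m, each C_t = (a^t_1 ∨ a^t_2 ∨ a^t_3) consisting of exactly 3 literals over variables x_1, ..., x_n. Construct the graph G on the 9m+2 vertices {g, r} ∪ {l^t_i, m^t_i, c^t_i : t ∈ {1,...,m}, i ∈ {1,2,3}} with the following edges: the edge (g,r); for each t and each i the edge (l^t_i, m^t_i); for each t and each i the edge (m^t_i, g); for each t the triangle on {c^t_1, c^t_2, c^t_3}; and, for every two literal-layer vertices l^{t_1}_i and l^{t_2}_j whose associated literals a^{t_1}_i and a^{t_2}_j are contrary (one is a variable and the other its negation), the edge (l^{t_1}_i, l^{t_2}_j). Take the partition of the vertex set into the 6m+2 parts {g}, {r}, the singletons {l^t_i}, and the pairs {m^t_i, c^t_i}. Then φ has a truth assignment making every clause true if and only if there exists a selection S of this partition such that the induced subgraph G[S] is 2-colorable. -/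

import Mathlib

/-- Vertices of the graph constructed in Theorem 4 from a 3-SAT formula with
`m` clauses: the two special vertices `g` and `r`, and for each clause `t` and
each position `i ∈ {1,2,3}` a literal-layer vertex `lit t i`, a middle-layer
vertex `mid t i` and a conflict-layer vertex `con t i` (in total `9m+2`
vertices). -/
inductive PCPVert (m : ℕ) : Type
  | g : PCPVert m
  | r : PCPVert m
  | lit : Fin m → Fin 3 → PCPVert m
  | mid : Fin m → Fin 3 → PCPVert m
  | con : Fin m → Fin 3 → PCPVert m
deriving DecidableEq

/-- The base (pre-symmetrization) edge relation of the construction of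
Theorem 4, where the 3-SAT formula is given by `a : Fin m → Fin 3 → Fin n × Bool`
(clause `t` has literals `a t 0, a t 1, a t 2`; a literal is a variable index
together with a sign, `true` for a positive literal `x` and `false` for `¬x`):
the edge (g,r); the edges (lit t i, mid t i); the edges (mid t i, g); the
triangle on the conflict layer of each clause; and an edge between any two
literal-layer vertices carrying contrary literals. -/
def pcpRel {m n : ℕ} (a : Fin m → Fin 3 → Fin n × Bool) :
    PCPVert m → PCPVert m → Prop
  | .g, .r => True
  | .lit t i, .mid t' i' => t = t' ∧ i = i'
  | .mid _ _, .g => True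
  | .con t _, .con t' _ => t = t'
  | .lit t i, .lit t' i' => (a t i).1 = (a t' i').1 ∧ (a t i).2 = !(a t' i').2
  | _, _ => False

/-- The colouring induced by an assignment: `g` and the true literals are `true`, while `r`, the
false literals and the middle layer are `false`. The conflict layer is coloured so that two
distinct vertices of a clause with false literals differ, unless all three literals are false. -/
def pcpColor {m n : ℕ} (a : Fin m → Fin 3 → Fin n × Bool) (b : Fin n → Bool) : PCPVert m → Bool
  | .g => true
  | .r => false
  | .lit t i => b (a t i).1 == (a t i).2
  | .mid _ _ => false
  | .con t i => i == 2 || (i == 1 && b (a t 0).1 != (a t 0).2)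

/-- The selection induced by an assignment: the middle vertex is taken exactly at true literals. -/
def pcpSelection {m n : ℕ} (a : Fin m → Fin 3 → Fin n × Bool) (b : Fin n → Bool) :
    Set (PCPVert m)
  | .mid t i => b (a t i).1 = (a t i).2
  | .con t i => b (a t i).1 ≠ (a t i).2
  | _ => True

theorem pcpColor_ne_of_rel {m n : ℕ} {a : Fin m → Fin 3 → Fin n × Bool} {b : Fin n → Bool}
    (hb : ∀ t, ∃ i, b (a t i).1 = (a t i).2) {u v : PCPVert m} (huv : u ≠ v)
    (hu : pcpSelection a b u) (hv : pcpSelection a b v) (h : pcpRel a u v) :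
    pcpColor a b u ≠ pcpColor a b v := by
  cases u <;> cases v <;> simp only [pcpRel] at h <;>
    simp only [pcpColor, pcpSelection] at hu hv ⊢
  · decide
  · obtain ⟨h1, h2⟩ := h
    rw [h1, h2]
    grind
  · obtain ⟨rfl, rfl⟩ := h
    simp [hv]
  · decide
  · rename_i t i t' j
    subst h
    obtain ⟨k, hk⟩ := hb t
    have hij : i ≠ j := fun e => huv (e ▸ rfl)
    fin_cases i <;> fin_cases j <;> fin_cases k <;> simp_all

theorem pcp_colorable_of_satisfies {m n : ℕ} {a : Fin m → Fin 3 → Fin n × Bool}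
    {b : Fin n → Bool} (hb : ∀ t, ∃ i, b (a t i).1 = (a t i).2) :
    ((SimpleGraph.fromRel (pcpRel a)).induce (pcpSelection a b)).Colorable 2 := by
  refine (SimpleGraph.Coloring.mk (fun v => pcpColor a b v.1) ?_).colorable
  rintro ⟨u, hu⟩ ⟨v, hv⟩ h
  rw [SimpleGraph.comap_adj, SimpleGraph.fromRel_adj] at h
  obtain ⟨hne, h | h⟩ := h
  · exact pcpColor_ne_of_rel hb hne hu hv h
  · exact (pcpColor_ne_of_rel hb hne.symm hv hu h).symm

theorem pcp_satisfiable_of_coloring {m n : ℕ} {a : Fin m → Fin 3 → Fin n × Bool}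
    {S : Set (PCPVert m)} (hg : PCPVert.g ∈ S) (hl : ∀ t i, PCPVert.lit t i ∈ S)
    (hmc : ∀ t i, PCPVert.con t i ∉ S → PCPVert.mid t i ∈ S)
    (c : ((SimpleGraph.fromRel (pcpRel a)).induce S).Coloring (Fin 2)) :
    ∃ b : Fin n → Bool, ∀ t, ∃ i, b (a t i).1 = (a t i).2 := by
  classical
  have hc : ∀ {u v} (hu : u ∈ S) (hv : v ∈ S), u ≠ v → pcpRel a u v → c ⟨u, hu⟩ ≠ c ⟨v, hv⟩ :=
    fun hu hv hne h => c.valid ((SimpleGraph.fromRel_adj _ _ _).2 ⟨hne, Or.inl h⟩)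
  refine ⟨fun x => decide (∃ t i, a t i = (x, true) ∧ c ⟨_, hl t i⟩ = c ⟨_, hg⟩), fun t => ?_⟩
  have hmid : ∃ i, PCPVert.mid t i ∈ S := by
    by_contra! hno
    have hcon : ∀ i, PCPVert.con t i ∈ S := fun i => by_contra fun h => hno i (hmc t i h)
    have h01 := hc (hcon 0) (hcon 1) (by simp) rfl
    have h02 := hc (hcon 0) (hcon 2) (by simp) rfl
    have h12 := hc (hcon 1) (hcon 2) (by simp) rfl
    omega
  obtain ⟨i, hi⟩ := hmid
  have hmg := hc hi hg (by simp) trivial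
  have hlm := hc (hl t i) hi (by simp) ⟨rfl, rfl⟩
  have hlg : c ⟨_, hl t i⟩ = c ⟨_, hg⟩ := by omega
  refine ⟨i, ?_⟩
  cases hs : (a t i).2 with
  | true => exact decide_eq_true ⟨t, i, Prod.ext rfl hs, hlg⟩
  | false =>
    refine decide_eq_false ?_
    rintro ⟨t', j, hj, hjg⟩
    refine hc (hl t' j) (hl t i) ?_ ⟨by rw [hj], by rw [hj, hs]; rfl⟩ (hjg.trans hlg.symm)
    rintro ⟨⟩
    exact Bool.false_ne_true (hs.symm.trans (congrArg Prod.snd hj))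

/-- Correctness of the reduction of Theorem 4 (PCP with `q = 2` and `k = 2` is
NP-complete): the 3-SAT formula `a` is satisfiable iff the constructed graph
has a selection `S` of the partition into the parts `{g}`, `{r}`, the
singletons `{lit t i}` and the pairs `{mid t i, con t i}` such that the induced
subgraph on `S` is 2-colorable. -/
theorem pcp_q2_k2_reduction_from_3SAT {m n : ℕ}
    (a : Fin m → Fin 3 → Fin n × Bool) :
    (∃ b : Fin n → Bool, ∀ t : Fin m, ∃ i : Fin 3, b (a t i).1 = (a t i).2)
    ↔ (∃ S : Set (PCPVert m),
        PCPVert.g ∈ S ∧ PCPVert.r ∈ S ∧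
        (∀ t i, PCPVert.lit t i ∈ S) ∧
        (∀ t i, (PCPVert.mid t i ∈ S ↔ PCPVert.con t i ∉ S)) ∧
        ((SimpleGraph.fromRel (pcpRel a)).induce S).Colorable 2) := by
  constructor
  · rintro ⟨b, hb⟩
    exact ⟨pcpSelection a b, trivial, trivial, fun _ _ => trivial,
      fun _ _ => not_not.symm, pcp_colorable_of_satisfies hb⟩
  · rintro ⟨S, hg, -, hl, hmc, ⟨c⟩⟩
    exact pcp_satisfiable_of_coloring hg hl (fun t i => (hmc t i).2) c
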